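/- arXiv:1905.07068 — 2 statements merged into one kernel-verified Lean document; each statement's English description precedes it below -/
import Mathlib

section
/- Let $p$ be a prime integer, $k$ a field of $\operatorname{char}(k) = p$, $F = k((\alpha))((\beta))$ the field of iterated Laurent series in two indeterminates over $k$, and $K = F[x : x^p - x = \beta^{-1}]$ the degree-$p$ Artin–Schreier field extension of $F$. Then $\alpha$ is not a norm of the extension $K/F$. -/
noncomputable def IterLaurentAux (k : Type) [Field k] : ℕ → (T : Type) × Field T
  | 0 => ⟨k, inferInstance⟩
  | n + 1 =>
      letI := (IterLaurentAux k n).2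
      ⟨LaurentSeries (IterLaurentAux k n).1, inferInstance⟩

/-- The field of iterated Laurent series `k((α₁))…((αₙ))` in `n` indeterminates over `k`. -/
noncomputable def IterLaurent (k : Type) [Field k] (n : ℕ) : Type :=
  (IterLaurentAux k n).1

noncomputable instance IterLaurent.instField (k : Type) [Field k] (n : ℕ) :
    Field (IterLaurent k n) :=
  (IterLaurentAux k n).2

/-- The indeterminates of `k((α₁))…((αₙ))`: `IterLaurent.var k n i` is `α_{i+1}`
(so `i = 0` gives the innermost variable `α₁` and `i = n-1` the outermost one `αₙ`). -/
noncomputable def IterLaurent.var (k : Type) [Field k] : ∀ n, Fin n → IterLaurent k n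
  | n + 1, i =>
      Fin.lastCases
        (show IterLaurent k (n + 1) from
          (HahnSeries.single (1 : ℤ) (1 : IterLaurent k n) : LaurentSeries (IterLaurent k n)))
        (fun j => show IterLaurent k (n + 1) from
          (HahnSeries.C (IterLaurent.var k n j) : LaurentSeries (IterLaurent k n)))
        i

open Polynomial in
theorem Matrix.det_aeval_of_isNilpotent {R n : Type*} [CommRing R] [IsDomain R] [Fintype n]
    [DecidableEq n] {N : Matrix n n R} (hN : IsNilpotent N) (P : R[X]) :
    (aeval N P).det = P.coeff 0 ^ Fintype.card n := by
  set Q : Matrix n n R := aeval N P.divX with hQ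
  have hP : aeval N P = algebraMap R _ (P.coeff 0) - -(Q * N) := by
    conv_lhs => rw [← P.divX_mul_X_add]
    simp [hQ, add_comm]
  have hcomm : Commute Q N := by
    have := (Commute.all P.divX X).map (aeval N)
    simpa [hQ] using this
  have hnil : IsNilpotent (-(Q * N)) := (hcomm.isNilpotent_mul_left hN).neg
  have hchar : (-(Q * N)).charpoly = X ^ Fintype.card n :=
    sub_eq_zero.1 (isNilpotent_charpoly_sub_pow_of_isNilpotent hnil).eq_zero
  have hscalar : algebraMap R (Matrix n n R) (P.coeff 0) = Matrix.scalar n (P.coeff 0) := rfl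
  rw [hP, hscalar, ← Matrix.eval_charpoly, hchar]
  simp

open Polynomial in
theorem RingHom.mapMatrix_aeval {R S n : Type*} [CommRing R] [CommRing S] [Fintype n]
    [DecidableEq n] (f : R →+* S) (M : Matrix n n R) (P : R[X]) :
    f.mapMatrix (aeval M P) = aeval (M.map f) (P.map f) := by
  rw [aeval_def, aeval_def, hom_eval₂, eval₂_map]
  congr 1
  ext r i j
  simp [Matrix.algebraMap_eq_diagonal, Matrix.diagonal_apply, apply_ite f]

open Polynomial in
theorem Algebra.exists_norm_aeval_eq_of_isNilpotent {A L F K n : Type*} [CommRing A] [CommRing L]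
    [IsDomain L] [CommRing F] [CommRing K] [Algebra A F] [Algebra F K] [Algebra A K]
    [IsScalarTower A F K] [Fintype n] [DecidableEq n] (b : Module.Basis n F K) (φ : A →+* L)
    {y : K} {M : Matrix n n A} (hM : leftMulMatrix b y = M.map (algebraMap A F))
    (hnil : IsNilpotent (M.map φ)) (P : A[X]) :
    ∃ a : A, algebraMap A F a = norm F (aeval y P) ∧
      φ a = φ (P.coeff 0) ^ Fintype.card n := by
  refine ⟨(aeval M P).det, ?_, ?_⟩
  · rw [norm_eq_matrix_det b, RingHom.map_det]
    congr 1
    rw [RingHom.mapMatrix_aeval, ← hM, aeval_algHom_apply, aeval_map_algebraMap]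
  · rw [RingHom.map_det, RingHom.mapMatrix_aeval, Matrix.det_aeval_of_isNilpotent hnil, coeff_map]

theorem Matrix.isNilpotent_of_strictUpper {R : Type*} [CommRing R] {n : ℕ}
    {N : Matrix (Fin n) (Fin n) R} (h : ∀ i j, j ≤ i → N i j = 0) : IsNilpotent N := by
  have hc : N.charpoly = Polynomial.X ^ n := by
    rw [Matrix.charpoly_of_isUpperTriangular]
    · simp [h]
    · intro i j hij
      exact h i j hij.le
  refine ⟨n, ?_⟩
  simpa [hc] using N.aeval_self_charpoly

/-- The matrix of multiplication by `x⁻¹` in the basis `1, x, …, x ^ (n - 1)`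
when `x ^ n - x = t⁻¹`. -/
def artinSchreierInvMatrix {A : Type*} [CommRing A] (n : ℕ) (t : A) : Matrix (Fin n) (Fin n) A :=
  fun i j => if (j : ℕ) = 0 then (if (i : ℕ) + 1 = n then t else 0) - (if (i : ℕ) = 0 then t else 0)
    else if (i : ℕ) + 1 = j then 1 else 0

theorem isNilpotent_map_artinSchreierInvMatrix {A L : Type*} [CommRing A] [CommRing L]
    (n : ℕ) {t : A} {φ : A →+* L} (ht : φ t = 0) :
    IsNilpotent ((artinSchreierInvMatrix n t).map φ) := by
  apply Matrix.isNilpotent_of_strictUpper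
  intro i j hij
  have hij' : (j : ℕ) ≤ i := hij
  simp only [artinSchreierInvMatrix, Matrix.map_apply]
  split_ifs <;> first | omega | simp [ht]

theorem leftMulMatrix_artinSchreierInv {A F K : Type*} [CommRing A] [Field F] [CommRing K]
    [Algebra A F] [Algebra F K] (pb : PowerBasis F K) (hn : 2 ≤ pb.dim)
    {t : A} {y : K} (hy : y = algebraMap F K (algebraMap A F t) * (pb.gen ^ (pb.dim - 1) - 1))
    (hxy : y * pb.gen = 1) :
    Algebra.leftMulMatrix pb.basis y = (artinSchreierInvMatrix pb.dim t).map (algebraMap A F) := by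
  ext i j
  rw [Algebra.leftMulMatrix_eq_repr_mul, Matrix.map_apply, artinSchreierInvMatrix]
  by_cases hj : (j : ℕ) = 0
  · have : y * pb.basis j = algebraMap A F t • pb.basis ⟨pb.dim - 1, by omega⟩
        - algebraMap A F t • pb.basis ⟨0, by omega⟩ := by
      simp only [pb.basis_eq_pow, hj, hy, Algebra.smul_def]
      ring
    rw [this]
    simp only [map_sub, map_smul, pb.basis.repr_self, Finsupp.sub_apply, Finsupp.smul_apply,
      Finsupp.single_apply, Fin.ext_iff, hj, if_true, smul_eq_mul]
    have e1 : (pb.dim - 1 = (i : ℕ)) ↔ ((i : ℕ) + 1 = pb.dim) := by omega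
    have e2 : (0 = (i : ℕ)) ↔ ((i : ℕ) = 0) := by omega
    simp only [e1, e2]
    split_ifs <;> simp
  · have : y * pb.basis j = pb.basis ⟨j - 1, by omega⟩ := by
      have e : (j : ℕ) = (j - 1) + 1 := by omega
      simp only [pb.basis_eq_pow]
      conv_lhs => rw [e, pow_succ, mul_left_comm, hxy, mul_one]
    rw [this, pb.basis.repr_self, Finsupp.single_apply]
    simp only [Fin.ext_iff, hj, if_false]
    have e1 : ((j : ℕ) - 1 = (i : ℕ)) ↔ ((i : ℕ) + 1 = j) := by omega
    simp only [e1]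
    split_ifs <;> simp

open Polynomial in
theorem exists_pow_eq_of_norm_artinSchreier {A L F K : Type*} [CommRing A] [CommRing L]
    [IsDomain L] [Field F] [CommRing K] [Algebra A F] [IsFractionRing A F] [Algebra F K]
    {φ : A →+* L} {t : A} (hker : ∀ a, φ a = 0 ↔ t ∣ a)
    (hloc : ∀ f : F, ∃ (m : ℕ) (a : A), algebraMap A F t ^ m * f = algebraMap A F a)
    (ht : t ≠ 0) (pb : PowerBasis F K) (hn : 2 ≤ pb.dim)
    (hx : pb.gen ^ pb.dim - pb.gen = algebraMap F K (algebraMap A F t)⁻¹)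
    (a : A) (z : K) (hz : Algebra.norm F z = algebraMap A F a) : ∃ c, φ a = c ^ pb.dim := by
  let _ : Algebra A K := ((algebraMap F K).comp (algebraMap A F)).toAlgebra
  have : IsScalarTower A F K := IsScalarTower.of_algebraMap_eq fun _ => rfl
  have hinj : Function.Injective (algebraMap A F) := IsFractionRing.injective A F
  set x := pb.gen
  set n := pb.dim with hn'
  set s : F := algebraMap A F t
  have hs : s ≠ 0 := by simpa [s] using (map_ne_zero_iff _ hinj).2 ht
  obtain ⟨y, hy⟩ : ∃ y : K, y = algebraMap F K s * (x ^ (n - 1) - 1) := ⟨_, rfl⟩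
  have hxy : y * x = 1 := by
    have : y * x = algebraMap F K s * (x ^ n - x) := by
      rw [hy]
      conv_rhs => rw [show n = n - 1 + 1 by omega, pow_succ]
      ring
    rw [this, hx, ← map_mul, mul_inv_cancel₀ hs, map_one]
  have key := Algebra.exists_norm_aeval_eq_of_isNilpotent pb.basis φ
    (leftMulMatrix_artinSchreierInv pb hn hy hxy)
    (isNilpotent_map_artinSchreierInvMatrix n ((hker t).2 dvd_rfl))
  rw [Fintype.card_fin, ← hn'] at key
  have hpow (m : ℕ) : y ^ m * x ^ m = 1 := by rw [← mul_pow, hxy, one_pow]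
  -- `t` is divisible by `y` in `A[y]`
  have hty : algebraMap A K t = y * aeval y (X ^ (n - 1) + C t * X ^ (n - 2) : A[X]) := by
    have h1 : algebraMap A K t * y ^ n * x ^ n = algebraMap A K t := by
      rw [mul_assoc, hpow, mul_one]
    have hAK : algebraMap A K t = algebraMap F K s := rfl
    have h2 : y ^ n = algebraMap A K t - algebraMap A K t * y ^ (n - 1) := by
      have e : n = (n - 1) + 1 := by omega
      have : y ^ n = y ^ (n - 1) * y := by conv_lhs => rw [e, pow_succ]
      rw [this]
      conv_lhs => rw [mul_comm]
      rw [← hAK] at hy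
      linear_combination y ^ (n - 1) * hy + (algebraMap A K t) * hpow (n - 1)
    have e1 : y * y ^ (n - 1) = y ^ n := by rw [← pow_succ']; congr 1; omega
    have e2 : y * y ^ (n - 2) = y ^ (n - 1) := by rw [← pow_succ']; congr 1; omega
    simp only [map_add, map_mul, map_pow, aeval_X, aeval_C]
    linear_combination (-1 : K) * h2 - e1 - algebraMap A K t * e2
  -- every element lies in `A[y]` after multiplying by a power of `y`
  have hex : ∃ (m : ℕ) (P : A[X]), y ^ m * z = aeval y P := by
    have hF (f : F) : ∃ (m : ℕ) (P : A[X]), y ^ m * algebraMap F K f = aeval y P := by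
      obtain ⟨m, b, hb⟩ := hloc f
      refine ⟨n * m, (1 - X ^ (n - 1)) ^ m * C b, ?_⟩
      have h1 : algebraMap F K f = algebraMap F K s⁻¹ ^ m * algebraMap A K b := by
        rw [IsScalarTower.algebraMap_apply A F K, ← hb, ← map_pow, ← map_mul, ← mul_assoc,
          ← mul_pow, inv_mul_cancel₀ hs, one_pow, one_mul]
      have h2 : y ^ n * algebraMap F K s⁻¹ = 1 - y ^ (n - 1) := by
        have e : y ^ n = y ^ (n - 1) * y := by rw [← pow_succ]; congr 1; omega
        rw [← hx, mul_sub, hpow, e, mul_assoc, hxy, mul_one]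
      rw [h1, pow_mul, ← mul_assoc, ← mul_pow, h2]
      simp
    have hzx : z ∈ Algebra.adjoin F {x} := by rw [pb.adjoin_gen_eq_top]; trivial
    clear hz
    induction hzx using Algebra.adjoin_induction with
    | mem w hw => 
      rw [Set.mem_singleton_iff.1 hw]
      exact ⟨1, 1, by simp [hxy]⟩
    | algebraMap f => exact hF f
    | add u v _ _ hu hv =>
      obtain ⟨m₁, P₁, h₁⟩ := hu
      obtain ⟨m₂, P₂, h₂⟩ := hv
      refine ⟨m₁ + m₂, X ^ m₂ * P₁ + X ^ m₁ * P₂, ?_⟩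
      simp only [map_add, map_mul, map_pow, aeval_X, ← h₁, ← h₂]
      ring
    | mul u v _ _ hu hv =>
      obtain ⟨m₁, P₁, h₁⟩ := hu
      obtain ⟨m₂, P₂, h₂⟩ := hv
      refine ⟨m₁ + m₂, P₁ * P₂, ?_⟩
      simp only [map_mul, ← h₁, ← h₂]
      ring
  classical
  obtain ⟨P, hP⟩ := Nat.find_spec hex
  rcases hm : Nat.find hex with _ | m
  · obtain ⟨a', ha', hφ⟩ := key P
    rw [← hP, hm, pow_zero, one_mul, hz] at ha'
    exact ⟨_, by rw [← hinj ha', hφ]⟩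
  · exfalso
    have hP0 : φ (P.coeff 0) ≠ 0 := by
      intro h0
      obtain ⟨c, hc⟩ := (hker _).1 h0
      refine Nat.find_min hex (m := m) (by omega)
        ⟨C c * (X ^ (n - 1) + C t * X ^ (n - 2)) + P.divX, ?_⟩
      have h1 : y * (y ^ m * z) = y * aeval y
          (C c * (X ^ (n - 1) + C t * X ^ (n - 2)) + P.divX) := by
        rw [← mul_assoc, ← pow_succ', ← hm, hP]
        conv_lhs => rw [← P.divX_mul_X_add, hc]
        rw [map_add, map_mul, aeval_C, map_mul, map_add, map_mul, aeval_C, hty, aeval_X]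
        ring
      have h2 := congrArg (x * ·) h1
      simpa [← mul_assoc, mul_comm x y, hxy] using h2
    obtain ⟨b, hb, hφb⟩ := key X
    obtain ⟨c, hc, hφc⟩ := key P
    rw [aeval_X] at hb
    rw [← hP, hm, map_mul, map_pow, ← hb, hz, ← map_pow, ← map_mul] at hc
    rw [hinj hc] at hφc
    rw [map_mul, map_pow, hφb] at hφc
    have : n ≠ 0 := by omega
    rw [coeff_X_zero, map_zero, zero_pow this, zero_pow m.succ_ne_zero, zero_mul] at hφc
    exact pow_ne_zero _ hP0 hφc.symm

open Polynomial in
theorem LaurentSeries.exists_pow_eq_of_norm_artinSchreier {L : Type*} [Field L] {p : ℕ}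
    (hp : 2 ≤ p) (a : L) {β : LaurentSeries L} (hβ : β = HahnSeries.single (1 : ℤ) (1 : L))
    (z : AdjoinRoot (X ^ p - X - C β⁻¹ : (LaurentSeries L)[X]))
    (hz : Algebra.norm (LaurentSeries L) z = HahnSeries.C a) : ∃ c, a = c ^ p := by
  have hX : algebraMap (PowerSeries L) (LaurentSeries L) PowerSeries.X = β :=
    hβ ▸ PowerSeries.coe_X
  have hdeg : (X + C β⁻¹).natDegree < (X ^ p : (LaurentSeries L)[X]).natDegree := by
    rw [natDegree_X_add_C, natDegree_X_pow]; exact hp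
  have hmon : (X ^ p - X - C β⁻¹).Monic := by
    rw [sub_sub]
    refine monic_X_pow_sub ?_
    rw [degree_X_add_C]
    exact_mod_cast hp
  have hnat : (X ^ p - X - C β⁻¹).natDegree = p := by
    rw [sub_sub, natDegree_sub_eq_left_of_natDegree_lt hdeg, natDegree_X_pow]
  have hroot := AdjoinRoot.eval₂_root (X ^ p - X - C β⁻¹)
  simp only [eval₂_sub, eval₂_pow, eval₂_X, eval₂_C, sub_eq_zero] at hroot
  have hloc (f : LaurentSeries L) : ∃ (m : ℕ) (b : PowerSeries L),
      algebraMap (PowerSeries L) (LaurentSeries L) PowerSeries.X ^ m * f =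
        algebraMap (PowerSeries L) (LaurentSeries L) b := by
    obtain ⟨⟨b, _, m, rfl⟩, h⟩ :=
      IsLocalization.surj (Submonoid.powers (PowerSeries.X : PowerSeries L)) f
    exact ⟨m, b, by rw [← h, mul_comm, map_pow]⟩
  have key := _root_.exists_pow_eq_of_norm_artinSchreier (φ := PowerSeries.constantCoeff)
    (fun _ => PowerSeries.X_dvd_iff.symm) hloc PowerSeries.X_ne_zero
    (AdjoinRoot.powerBasis' hmon) (by simpa [hnat] using hp)
    (by rw [hX]; simpa [hnat] using hroot) (PowerSeries.C a) z
    (hz.trans (PowerSeries.coe_C a).symm)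
  simpa [hnat] using key

theorem LaurentSeries.single_one_ne_pow {L : Type*} [Field L] {p : ℕ} (hp : 2 ≤ p)
    (c : LaurentSeries L) : HahnSeries.single (1 : ℤ) (1 : L) ≠ c ^ p := by
  intro h
  have := congrArg HahnSeries.order h
  rw [HahnSeries.order_single one_ne_zero, HahnSeries.order_pow, nsmul_eq_mul] at this
  have h1 := Int.eq_one_or_neg_one_of_mul_eq_one this.symm
  omega

/-- Let `p` be prime, `k` a field of characteristic `p`,
`F = k((α))((β))` the field of iterated Laurent series in two indeterminates, and
`K = F[x : x^p - x = β⁻¹]` the degree-`p` Artin–Schreier extension of `F`.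
Then `α` is not a norm of the extension `K/F`. -/
theorem iterLaurent_artinSchreier_norm_ne (p : ℕ) (hp : p.Prime) (k : Type) [Field k]
    [CharP k p] :
    ∀ z : AdjoinRoot (Polynomial.X ^ p - Polynomial.X -
        Polynomial.C (IterLaurent.var k 2 1)⁻¹ : Polynomial (IterLaurent k 2)),
      Algebra.norm (IterLaurent k 2) z ≠ IterLaurent.var k 2 0 := by
  intro z hz
  obtain ⟨c, hc⟩ := LaurentSeries.exists_pow_eq_of_norm_artinSchreier (L := IterLaurent k 1)
    hp.two_le (HahnSeries.single (1 : ℤ) (1 : IterLaurent k 0) : LaurentSeries (IterLaurent k 0))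
    rfl z hz
  exact LaurentSeries.single_one_ne_pow hp.two_le _ hc
end

section
/- Let $p$ be a prime integer, $k$ a field of $\operatorname{char}(k) = p$, and $F = k((\alpha))((\beta))$ the field of iterated Laurent series in two indeterminates over $k$. Then the degree-$p$ symbol algebra $[\beta^{-1}, \alpha)_{p,F}$ is a division algebra over $F$. -/
noncomputable def SymGenX (F : Type) [Field F] : FreeAlgebra F (Fin 2) := FreeAlgebra.ι F 0
noncomputable def SymGenY (F : Type) [Field F] : FreeAlgebra F (Fin 2) := FreeAlgebra.ι F 1

/-- Relations of the symbol algebra `[a,b)_{p,F}` in characteristic `p`: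
`x^p - x = a`, `y^p = b`, `y x = (x + 1) y` (i.e. `y x y⁻¹ = x + 1`). -/
inductive ASSymbolRel (F : Type) [Field F] (p : ℕ) (a b : F) :
    FreeAlgebra F (Fin 2) → FreeAlgebra F (Fin 2) → Prop
  | x : ASSymbolRel F p a b (SymGenX F ^ p - SymGenX F) (algebraMap F _ a)
  | y : ASSymbolRel F p a b (SymGenY F ^ p) (algebraMap F _ b)
  | comm : ASSymbolRel F p a b (SymGenY F * SymGenX F) ((SymGenX F + 1) * SymGenY F)

/-- The degree-`p` symbol algebra `[a,b)_{p,F} = F⟨x,y : x^p - x = a, y^p = b, yxy⁻¹ = x+1⟩`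
in characteristic `p`. -/
noncomputable def ASSymbol (F : Type) [Field F] (p : ℕ) (a b : F) : Type :=
  RingQuot (ASSymbolRel F p a b)

noncomputable instance (F : Type) [Field F] (p : ℕ) (a b : F) : Ring (ASSymbol F p a b) :=
  inferInstanceAs (Ring (RingQuot (ASSymbolRel F p a b)))

noncomputable instance (F : Type) [Field F] (p : ℕ) (a b : F) : Algebra F (ASSymbol F p a b) :=
  inferInstanceAs (Algebra F (RingQuot (ASSymbolRel F p a b)))

/-- A (possibly noncommutative) ring is a division ring iff it is nontrivial and
every nonzero element is invertible. -/
def IsDivisionAlgebra (D : Type) [Ring D] : Prop :=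
  Nontrivial D ∧ ∀ x : D, x ≠ 0 → IsUnit x

namespace ASSymbol

section Span

variable {F A : Type*} [Field F] [Ring A] [Algebra F A]

/-- The span of the monomials `x ^ i * y ^ j` with `i, j < p`. -/
def monomialSpan (F : Type*) {A : Type*} [Field F] [Ring A] [Algebra F A] (p : ℕ) (x y : A) :
    Submodule F A :=
  Submodule.span F (Set.range fun ij : Fin p × Fin p => x ^ (ij.1 : ℕ) * y ^ (ij.2 : ℕ))

variable {p : ℕ} {a b : F} {x y : A}

theorem pow_mul_pow_mem_monomialSpan (hp : 1 < p) (hx : x ^ p - x = algebraMap F A a)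
    (hy : y ^ p = algebraMap F A b) (i j : ℕ) : x ^ i * y ^ j ∈ monomialSpan F p x y := by
  induction j using Nat.strong_induction_on generalizing i with
  | _ j ihj =>
    by_cases hj : j < p
    · induction i using Nat.strong_induction_on with
      | _ i ihi =>
        by_cases hi : i < p
        · exact Submodule.subset_span ⟨(⟨i, hi⟩, ⟨j, hj⟩), rfl⟩
        · obtain ⟨l, rfl⟩ := Nat.exists_eq_add_of_le (not_lt.mp hi)
          have hxp : x ^ p = x + algebraMap F A a := by rw [← hx]; abel
          have key : x ^ (p + l) * y ^ j = x ^ (l + 1) * y ^ j + a • (x ^ l * y ^ j) := by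
            rw [pow_add, hxp, add_mul, ← pow_succ', add_mul, Algebra.smul_def, mul_assoc _ (x ^ l)]
          rw [key]
          exact add_mem (ihi _ (by omega)) (Submodule.smul_mem _ _ (ihi _ (by omega)))
    · obtain ⟨l, rfl⟩ := Nat.exists_eq_add_of_le (not_lt.mp hj)
      have key : x ^ i * y ^ (p + l) = b • (x ^ i * y ^ l) := by
        rw [pow_add, hy, ← Algebra.smul_def, mul_smul_comm]
      rw [key]
      exact Submodule.smul_mem _ _ (ihj _ (by omega) _)

theorem y_mul_x_pow (hxy : y * x = (x + 1) * y) (i : ℕ) :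
    y * x ^ i = (x + 1) ^ i * y := by
  induction i with
  | zero => simp
  | succ i ih => rw [pow_succ, ← mul_assoc, ih, mul_assoc, hxy, ← mul_assoc, ← pow_succ]

theorem x_mul_mem_monomialSpan (hp : 1 < p) (hx : x ^ p - x = algebraMap F A a)
    (hy : y ^ p = algebraMap F A b) {s : A} (hs : s ∈ monomialSpan F p x y) :
    x * s ∈ monomialSpan F p x y := by
  refine Submodule.span_induction (p := fun s _ => x * s ∈ monomialSpan F p x y)
    ?_ (by simp) (fun u v _ _ hu hv => ?_) (fun c u _ hu => ?_) hs
  · rintro _ ⟨⟨i, j⟩, rfl⟩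
    rw [← mul_assoc, ← pow_succ']
    exact pow_mul_pow_mem_monomialSpan hp hx hy _ _
  · rw [mul_add]; exact add_mem hu hv
  · rw [mul_smul_comm]; exact Submodule.smul_mem _ _ hu

theorem y_mul_mem_monomialSpan (hp : 1 < p) (hx : x ^ p - x = algebraMap F A a)
    (hy : y ^ p = algebraMap F A b) (hxy : y * x = (x + 1) * y) {s : A}
    (hs : s ∈ monomialSpan F p x y) : y * s ∈ monomialSpan F p x y := by
  refine Submodule.span_induction (p := fun s _ => y * s ∈ monomialSpan F p x y)
    ?_ (by simp) (fun u v _ _ hu hv => ?_) (fun c u _ hu => ?_) hs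
  · rintro _ ⟨⟨i, j⟩, rfl⟩
    have key : y * (x ^ (i : ℕ) * y ^ (j : ℕ)) =
        ∑ l ∈ Finset.range (i + 1), (Nat.choose i l : F) • (x ^ l * y ^ (j + 1 : ℕ)) := by
      rw [← mul_assoc, y_mul_x_pow hxy, mul_assoc, ← pow_succ',
        (Commute.one_right x).add_pow, Finset.sum_mul]
      refine Finset.sum_congr rfl fun l _ => ?_
      rw [one_pow, mul_one, ← Nat.cast_comm, mul_assoc, Algebra.smul_def, map_natCast]
    dsimp only
    rw [key]
    exact sum_mem fun l _ => Submodule.smul_mem _ _ (pow_mul_pow_mem_monomialSpan hp hx hy _ _)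
  · rw [mul_add]; exact add_mem hu hv
  · rw [mul_smul_comm]; exact Submodule.smul_mem _ _ hu

end Span

section Generators

variable (F : Type) [Field F] (p : ℕ) (a b : F)

/-- The quotient map from the free algebra onto the symbol algebra. -/
noncomputable def mk : FreeAlgebra F (Fin 2) →ₐ[F] ASSymbol F p a b :=
  RingQuot.mkAlgHom F (ASSymbolRel F p a b)

theorem mk_surjective : Function.Surjective (mk F p a b) :=
  RingQuot.mkAlgHom_surjective F (ASSymbolRel F p a b)

variable {F p a b}

theorem mk_rel {u v : FreeAlgebra F (Fin 2)} (h : ASSymbolRel F p a b u v) :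
    mk F p a b u = mk F p a b v :=
  RingQuot.mkAlgHom_rel F h

variable (F p a b)

/-- The Artin–Schreier generator of the symbol algebra. -/
noncomputable def x : ASSymbol F p a b := mk F p a b (SymGenX F)

/-- The Kummer-type generator of the symbol algebra. -/
noncomputable def y : ASSymbol F p a b := mk F p a b (SymGenY F)

theorem x_pow_sub : x F p a b ^ p - x F p a b = algebraMap F _ a := by
  simpa [x] using mk_rel (ASSymbolRel.x (F := F) (p := p) (a := a) (b := b))

theorem y_pow : y F p a b ^ p = algebraMap F _ b := by
  simpa [y] using mk_rel (ASSymbolRel.y (F := F) (p := p) (a := a) (b := b))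

theorem y_mul_x : y F p a b * x F p a b = (x F p a b + 1) * y F p a b := by
  simpa [x, y] using mk_rel (ASSymbolRel.comm (F := F) (p := p) (a := a) (b := b))

variable {p}

theorem monomialSpan_eq_top (hp : 1 < p) : monomialSpan F p (x F p a b) (y F p a b) = ⊤ := by
  have key : ∀ u : FreeAlgebra F (Fin 2), ∀ s ∈ monomialSpan F p (x F p a b) (y F p a b),
      mk F p a b u * s ∈ monomialSpan F p (x F p a b) (y F p a b) := by
    intro u
    induction u with
    | grade0 r =>
      intro s hs
      rw [AlgHom.commutes, ← Algebra.smul_def]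
      exact Submodule.smul_mem _ _ hs
    | grade1 i =>
      intro s hs
      fin_cases i
      · exact x_mul_mem_monomialSpan hp (x_pow_sub F p a b) (y_pow F p a b) hs
      · exact y_mul_mem_monomialSpan hp (x_pow_sub F p a b) (y_pow F p a b)
          (y_mul_x F p a b) hs
    | mul u v hu hv =>
      intro s hs
      rw [map_mul, mul_assoc]
      exact hu _ (hv _ hs)
    | add u v hu hv =>
      intro s hs
      rw [map_add, add_mul]
      exact add_mem (hu _ hs) (hv _ hs)
  rw [eq_top_iff]
  intro z _
  obtain ⟨u, rfl⟩ := mk_surjective F p a b z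
  have := key u 1 (by
    simpa using pow_mul_pow_mem_monomialSpan hp (x_pow_sub F p a b) (y_pow F p a b) 0 0)
  rwa [mul_one] at this

theorem finiteDimensional (hp : 1 < p) : FiniteDimensional F (ASSymbol F p a b) := by
  refine ⟨?_⟩
  rw [← monomialSpan_eq_top F a b hp]
  exact Submodule.fg_span (Set.finite_range _)

variable {F a b}

theorem exists_eq_sum (hp : 1 < p) (z : ASSymbol F p a b) :
    ∃ c : Fin p → Fin p → F,
      z = ∑ i, ∑ j, c i j • (x F p a b ^ (i : ℕ) * y F p a b ^ (j : ℕ)) := by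
  have hz : z ∈ monomialSpan F p (x F p a b) (y F p a b) := by
    rw [monomialSpan_eq_top F a b hp]; trivial
  obtain ⟨c, hc⟩ := (Submodule.mem_span_range_iff_exists_fun F).mp hz
  refine ⟨fun i j => c (i, j), ?_⟩
  rw [← hc, Fintype.sum_prod_type]

/-- A symbol algebra is a division algebra as soon as it acts on a field extension `M` of `F`,
with `x` acting by multiplication by `X` and `y` acting by `Y • σ`, in such a way that every
nontrivial combination of the monomials `x ^ i * y ^ j` acts injectively. -/
theorem isDivisionAlgebra_of_semilinear {M : Type*} [Field M] (hp : 1 < p) (φ : F →+* M)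
    (σ : M →+* M) (hσφ : ∀ c, σ (φ c) = φ c) {X Y : M} (hX : X ^ p - X = φ a) (hY : Y ^ p = φ b)
    (hσX : σ X = X + 1) (hσY : σ Y = Y) (hσp : ∀ m, σ^[p] m = m)
    (H : ∀ c : Fin p → Fin p → F, c ≠ 0 → ∀ m ≠ 0,
      ∑ i, ∑ j, φ (c i j) * (X ^ (i : ℕ) * (Y ^ (j : ℕ) * σ^[j] m)) ≠ 0) :
    IsDivisionAlgebra (ASSymbol F p a b) := by
  let _ : Algebra F M := φ.toAlgebra
  have smul_eq (c : F) (m : M) : c • m = φ c * m := rfl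
  let σl : Module.End F M :=
    { toFun := σ
      map_add' := map_add σ
      map_smul' := fun c m => by simp [smul_eq, hσφ] }
  let Xl : Module.End F M := LinearMap.mulLeft F X
  let Yl : Module.End F M := LinearMap.mulLeft F Y * σl
  have Xl_apply (m : M) : Xl m = X * m := rfl
  have Yl_apply (m : M) : Yl m = Y * σ m := rfl
  have Xl_pow (i : ℕ) (m : M) : (Xl ^ i) m = X ^ i * m := by
    induction i generalizing m with
    | zero => simp
    | succ i ih => rw [pow_succ, Module.End.mul_apply, ih, Xl_apply]; ring
  have Yl_pow (j : ℕ) (m : M) : (Yl ^ j) m = Y ^ j * σ^[j] m := by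
    induction j generalizing m with
    | zero => simp
    | succ j ih =>
      rw [pow_succ', Module.End.mul_apply, ih, Yl_apply, Function.iterate_succ_apply', map_mul,
        map_pow, hσY]
      ring
  let g : FreeAlgebra F (Fin 2) →ₐ[F] Module.End F M := FreeAlgebra.lift F ![Xl, Yl]
  have gX : g (SymGenX F) = Xl := by simp [g, SymGenX]
  have gY : g (SymGenY F) = Yl := by simp [g, SymGenY]
  have hg : ∀ ⦃u v⦄, ASSymbolRel F p a b u v → g u = g v := by
    intro u v h
    cases h with
    | x =>
      refine LinearMap.ext fun m => ?_
      rw [map_sub, map_pow, gX, AlgHom.commutes, LinearMap.sub_apply, Xl_pow, Xl_apply,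
        Module.algebraMap_end_apply, smul_eq, ← hX]
      ring
    | y =>
      refine LinearMap.ext fun m => ?_
      rw [map_pow, gY, AlgHom.commutes, Yl_pow, Module.algebraMap_end_apply, smul_eq, ← hY, hσp]
    | comm =>
      refine LinearMap.ext fun m => ?_
      rw [map_mul, map_mul, map_add, map_one, gX, gY]
      change Yl (Xl m) = Xl (Yl m) + Yl m
      rw [Xl_apply, Xl_apply, Yl_apply, Yl_apply, map_mul, hσX]
      ring
  let ρ : ASSymbol F p a b →ₐ[F] Module.End F M := RingQuot.liftAlgHom F ⟨g, hg⟩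
  have ρ_mk (u) : ρ (mk F p a b u) = g u := RingQuot.liftAlgHom_mkAlgHom_apply F g hg u
  have ρx : ρ (x F p a b) = Xl := (ρ_mk _).trans gX
  have ρy : ρ (y F p a b) = Yl := (ρ_mk _).trans gY
  have ρ_ne (z : ASSymbol F p a b) (hz : z ≠ 0) (m : M) (hm : m ≠ 0) : ρ z m ≠ 0 := by
    obtain ⟨c, rfl⟩ := exists_eq_sum hp z
    have hc : c ≠ 0 := by
      rintro rfl
      simp at hz
    convert H c hc m hm using 1
    simp only [map_sum, map_smul, map_mul, map_pow, ρx, ρy, LinearMap.sum_apply,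
      LinearMap.smul_apply, Module.End.mul_apply, Xl_pow, Yl_pow, smul_eq]
  have hnt : Nontrivial (ASSymbol F p a b) := ρ.toRingHom.domain_nontrivial
  have : NoZeroDivisors (ASSymbol F p a b) := by
    refine ⟨fun {z w} hzw => ?_⟩
    by_contra! h
    refine ρ_ne z h.1 _ (ρ_ne w h.2 1 one_ne_zero) ?_
    rw [← Module.End.mul_apply, ← map_mul, hzw, map_zero, LinearMap.zero_apply]
  have : IsDomain (ASSymbol F p a b) := NoZeroDivisors.to_isDomain _
  have := finiteDimensional F a b hp
  refine ⟨hnt, fun z hz => ?_⟩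
  obtain ⟨w, hw⟩ := FiniteDimensional.exists_mul_eq_one F hz
  exact IsUnit.of_mul_eq_one _ hw

end Generators

end ASSymbol

namespace LaurentSeries

open HahnSeries

section Lead

variable {L : Type*} [Field L]

/-- `HasLead f n c` says that `f = c * X ^ n + (terms of degree greater than n)`; here `c` is
allowed to vanish. -/
def HasLead (f : LaurentSeries L) (n : ℤ) (c : L) : Prop :=
  ∃ w : PowerSeries L, PowerSeries.constantCoeff w = c ∧ f = single n 1 * ofPowerSeries ℤ L w

namespace HasLead

variable {f g : LaurentSeries L} {m n : ℤ} {c d : L}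

theorem coeff_eq (h : HasLead f n c) : f.coeff n = c := by
  obtain ⟨w, rfl, rfl⟩ := h
  have := coeff_single_mul_add (r := (1 : L)) (x := ofPowerSeries ℤ L w) (a := 0) (b := n)
  rw [zero_add, one_mul] at this
  rw [this, ← Nat.cast_zero, coeff_coe_powerSeries, PowerSeries.coeff_zero_eq_constantCoeff]

theorem coeff_of_lt (h : HasLead f n c) (hm : m < n) : f.coeff m = 0 := by
  obtain ⟨w, rfl, rfl⟩ := h
  have := coeff_single_mul_add (r := (1 : L)) (x := ofPowerSeries ℤ L w) (a := m - n) (b := n)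
  rw [sub_add_cancel, one_mul] at this
  rw [this, PowerSeries.coeff_coe, if_pos (by omega)]

theorem ne_zero (h : HasLead f n c) (hc : c ≠ 0) : f ≠ 0 := by
  rintro rfl
  exact hc h.coeff_eq.symm

theorem coe (w : PowerSeries L) :
    HasLead (ofPowerSeries ℤ L w) 0 (PowerSeries.constantCoeff w) :=
  ⟨w, rfl, by rw [single_zero_one, one_mul]⟩

theorem single (n : ℤ) (c : L) : HasLead (HahnSeries.single n c) n c :=
  ⟨PowerSeries.C c, by simp, by simp [C_apply]⟩

theorem C (c : L) : HasLead (HahnSeries.C c) 0 c := HasLead.single 0 c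

theorem mul (hf : HasLead f m c) (hg : HasLead g n d) : HasLead (f * g) (m + n) (c * d) := by
  obtain ⟨v, rfl, rfl⟩ := hf
  obtain ⟨w, rfl, rfl⟩ := hg
  refine ⟨v * w, map_mul _ _ _, ?_⟩
  rw [map_mul, mul_mul_mul_comm, single_mul_single, one_mul]

theorem pow (hf : HasLead f m c) (i : ℕ) : HasLead (f ^ i) (i * m) (c ^ i) := by
  induction i with
  | zero => simpa using HasLead.single 0 (1 : L)
  | succ i ih =>
    rw [pow_succ, pow_succ]
    convert ih.mul hf using 1
    push_cast
    ring

theorem inv (hf : HasLead f m c) (hc : c ≠ 0) : HasLead f⁻¹ (-m) c⁻¹ := by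
  obtain ⟨w, rfl, rfl⟩ := hf
  refine ⟨w⁻¹, PowerSeries.constantCoeff_inv w, ?_⟩
  refine (eq_inv_of_mul_eq_one_left ?_).symm
  rw [mul_mul_mul_comm, ← map_mul, PowerSeries.inv_mul_cancel _ hc, single_mul_single]
  simp

theorem zpow_one (hf : HasLead f m 1) (i : ℤ) : HasLead (f ^ i) (i * m) 1 := by
  obtain ⟨i, rfl | rfl⟩ := i.eq_nat_or_neg
  · simpa using hf.pow i
  · simpa using (hf.pow i).inv (by simp)

theorem add (hf : HasLead f n c) (hg : HasLead g n d) : HasLead (f + g) n (c + d) := by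
  obtain ⟨v, rfl, rfl⟩ := hf
  obtain ⟨w, rfl, rfl⟩ := hg
  exact ⟨v + w, map_add _ _ _, by rw [map_add, mul_add]⟩

theorem zero (n : ℤ) : HasLead (0 : LaurentSeries L) n 0 := ⟨0, by simp, by simp⟩

theorem sum {ι : Type*} (s : Finset ι) {f : ι → LaurentSeries L} {c : ι → L}
    (h : ∀ i ∈ s, HasLead (f i) n (c i)) : HasLead (∑ i ∈ s, f i) n (∑ i ∈ s, c i) := by
  induction s using Finset.cons_induction with
  | empty => exact zero n
  | cons a s ha ih =>
    rw [Finset.sum_cons, Finset.sum_cons]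
    exact (h a (Finset.mem_cons_self a s)).add
      (ih fun i hi => h i (Finset.mem_cons_of_mem hi))

theorem of_le_order (f : LaurentSeries L) (h : n ≤ f.order) : HasLead f n (f.coeff n) := by
  obtain ⟨i, hi⟩ := Int.le.dest h
  have key : f = HahnSeries.single n 1 *
      ofPowerSeries ℤ L (PowerSeries.X ^ i * f.powerSeriesPart) := by
    conv_lhs => rw [← single_order_mul_powerSeriesPart f, ← hi]
    rw [map_mul, ofPowerSeries_X_pow, ← mul_assoc, single_mul_single, one_mul]
  have lead : HasLead f n _ := ⟨_, rfl, key⟩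
  rwa [lead.coeff_eq]

end HasLead

/-- A sum of Laurent series whose nonzero terms have pairwise distinct orders is nonzero as soon
as some term is. -/
theorem sum_ne_zero_of_hasLead {ι : Type*} [Fintype ι] {f : ι → LaurentSeries L} {N : ι → ℤ}
    {c : ι → L} (hf : ∀ i, c i ≠ 0 → HasLead (f i) (N i) (c i)) (h0 : ∀ i, c i = 0 → f i = 0)
    (hN : Function.Injective N) (hc : ∃ i, c i ≠ 0) : ∑ i, f i ≠ 0 := by
  classical
  obtain ⟨i, hi, hmin⟩ := Finset.exists_min_image (Finset.univ.filter fun i => c i ≠ 0) N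
    (by simpa [Finset.filter_nonempty_iff] using hc)
  simp only [Finset.mem_filter, Finset.mem_univ, true_and] at hi hmin
  have key : (∑ j, f j).coeff (N i) = c i := by
    rw [coeff_sum, Finset.sum_eq_single i, (hf i hi).coeff_eq]
    · intro j _ hji
      by_cases hj : c j = 0
      · rw [h0 j hj, coeff_zero]
      · exact (hf j hj).coeff_of_lt (lt_of_le_of_ne (hmin j hj) fun h => hji (hN h.symm))
    · simp
  intro h
  rw [h, coeff_zero] at key
  exact hi key.symm

end Lead

theorem injective_mul_add_mul {p : ℕ} {e : ℤ} (he : IsUnit e) (n : Fin p → ℤ) (d : ℤ) :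
    Function.Injective fun i : Fin p => p * n i + e * i + d := by
  intro i j hij
  dsimp only at hij
  have hdvd : (p : ℤ) ∣ e * (i - j) := ⟨n j - n i, by linear_combination hij⟩
  have hdvd' : (p : ℤ) ∣ i - j := he.dvd_mul_left.mp hdvd
  have h0 := Int.eq_zero_of_abs_lt_dvd hdvd' (by rw [abs_lt]; constructor <;> omega)
  ext
  omega

section Subst

variable {K L M : Type*} [Field K] [Field L] [Field M]

/-- A ring homomorphism of Laurent series fields which maps power series to power series and
induces `g` on constant coefficients. -/
def Reduces (Φ : LaurentSeries K →+* LaurentSeries L) (g : K →+* L) : Prop :=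
  ∀ u : PowerSeries K, ∃ w : PowerSeries L,
    PowerSeries.constantCoeff w = g (PowerSeries.constantCoeff u) ∧
      Φ (ofPowerSeries ℤ K u) = ofPowerSeries ℤ L w

theorem Reduces.comp {Φ : LaurentSeries K →+* LaurentSeries L} {g : K →+* L}
    {Ψ : LaurentSeries L →+* LaurentSeries M} {h : L →+* M} (hΨ : Reduces Ψ h)
    (hΦ : Reduces Φ g) : Reduces (Ψ.comp Φ) (h.comp g) := by
  intro u
  obtain ⟨v, hv, hv'⟩ := hΦ u
  obtain ⟨w, hw, hw'⟩ := hΨ v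
  exact ⟨w, by rw [hw, hv, RingHom.comp_apply], by rw [RingHom.comp_apply, hv', hw']⟩

theorem Reduces.id : Reduces (RingHom.id (LaurentSeries K)) (RingHom.id K) :=
  fun u => ⟨u, rfl, rfl⟩

theorem Reduces.hasLead {Φ : LaurentSeries K →+* LaurentSeries L} {g : K →+* L}
    (hΦ : Reduces Φ g) {e : ℤ} (he : HasLead (Φ (single 1 1)) e 1) {f : LaurentSeries K} {n : ℤ}
    {c : K} (hf : HasLead f n c) : HasLead (Φ f) (e * n) (g c) := by
  obtain ⟨u, rfl, rfl⟩ := hf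
  obtain ⟨w, hw, hw'⟩ := hΦ u
  rw [map_mul, hw', ← hw, RatFunc.single_zpow, map_zpow₀]
  convert (he.zpow_one n).mul (HasLead.coe w) using 1
  · ring
  · rw [one_mul]

/-- Ring homomorphisms between Laurent series fields which preserve power series are determined by
their values on constants and on the variable. -/
theorem Reduces.ext {Φ Ψ : LaurentSeries K →+* LaurentSeries L} {g h : K →+* L}
    (hΦ : Reduces Φ g) (hΨ : Reduces Ψ h) (hC : ∀ c, Φ (HahnSeries.C c) = Ψ (HahnSeries.C c))
    (hX : Φ (single 1 1) = Ψ (single 1 1)) : Φ = Ψ := by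
  obtain ⟨t, ht, htX⟩ := hΦ PowerSeries.X
  rw [PowerSeries.constantCoeff_X, map_zero] at ht
  rw [ofPowerSeries_X] at htX
  have key : ∀ (n : ℕ) (u : PowerSeries K) (v w : PowerSeries L),
      Φ (ofPowerSeries ℤ K u) = ofPowerSeries ℤ L v →
      Ψ (ofPowerSeries ℤ K u) = ofPowerSeries ℤ L w → PowerSeries.X ^ n ∣ v - w := by
    intro n
    induction n with
    | zero => intro u v w _ _; simp
    | succ n ih =>
      intro u v w hv hw
      obtain ⟨u', hu'⟩ := PowerSeries.X_dvd_iff.mpr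
        (show PowerSeries.constantCoeff (u - PowerSeries.C (PowerSeries.constantCoeff u)) = 0 by
          simp)
      obtain ⟨v', -, hv'⟩ := hΦ u'
      obtain ⟨w', -, hw'⟩ := hΨ u'
      have hu : u = PowerSeries.C (PowerSeries.constantCoeff u) + PowerSeries.X * u' := by
        rw [← hu']; ring
      rw [hu, map_add, map_mul, ofPowerSeries_X, ofPowerSeries_C, map_add, map_mul] at hv hw
      have hvw : v - w = t * (v' - w') := by
        apply ofPowerSeries_injective (Γ := ℤ)
        rw [map_sub, map_mul, map_sub, ← hv, ← hw, ← hv', ← hw', ← htX, hC, hX]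
        ring
      rw [hvw, pow_succ']
      exact mul_dvd_mul (PowerSeries.X_dvd_iff.mpr ht) (ih u' v' w' hv' hw')
  apply IsLocalization.ringHom_ext (nonZeroDivisors (PowerSeries K))
  refine RingHom.ext fun u => ?_
  obtain ⟨v, -, hv⟩ := hΦ u
  obtain ⟨w, -, hw⟩ := hΨ u
  have hvw : v - w = 0 := by
    ext n
    exact PowerSeries.X_pow_dvd_iff.mp (key (n + 1) u v w hv hw) n n.lt_succ_self
  change Φ (ofPowerSeries ℤ K u) = Ψ (ofPowerSeries ℤ K u)
  rw [hv, hw, sub_eq_zero.mp hvw]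

/-- Existence of the substitution homomorphism `∑ aₙ Xⁿ ↦ ∑ g(aₙ) Tⁿ`. -/
theorem exists_subst (g : K →+* L) {T : PowerSeries L} (hT : PowerSeries.constantCoeff T = 0)
    (hT0 : T ≠ 0) : ∃ Φ : LaurentSeries K →+* LaurentSeries L, Reduces Φ g ∧
      Φ (single 1 1) = ofPowerSeries ℤ L T ∧ ∀ c, Φ (HahnSeries.C c) = HahnSeries.C (g c) := by
  have hs : PowerSeries.HasSubst T := PowerSeries.HasSubst.of_constantCoeff_zero' hT
  let s : PowerSeries K →+* PowerSeries L :=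
    (PowerSeries.substAlgHom (R := L) hs : PowerSeries L →+* PowerSeries L).comp
      (PowerSeries.map g)
  have sX : s PowerSeries.X = T := by
    change PowerSeries.substAlgHom (R := L) hs (PowerSeries.map g PowerSeries.X) = T
    rw [PowerSeries.map_X, PowerSeries.substAlgHom_X]
  have sC (c : K) : s (PowerSeries.C c) = PowerSeries.C (g c) := by
    change PowerSeries.substAlgHom (R := L) hs (PowerSeries.map g (PowerSeries.C c)) = _
    rw [PowerSeries.map_C]
    exact (PowerSeries.substAlgHom (R := L) hs).commutes (g c)
  have s0 (u : PowerSeries K) :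
      PowerSeries.constantCoeff (s u) = g (PowerSeries.constantCoeff u) := by
    obtain ⟨u', hu'⟩ := PowerSeries.X_dvd_iff.mpr
      (show PowerSeries.constantCoeff (u - PowerSeries.C (PowerSeries.constantCoeff u)) = 0 by
        simp)
    have hu : u = PowerSeries.C (PowerSeries.constantCoeff u) + PowerSeries.X * u' := by
      rw [← hu']; ring
    rw [hu, map_add, map_mul, sX, sC]
    simp [hT]
  have hunit : IsUnit (((ofPowerSeries ℤ L).comp s) (PowerSeries.X : PowerSeries K)) := by
    rw [isUnit_iff_ne_zero, RingHom.comp_apply, sX, Ne, map_eq_zero_iff _ ofPowerSeries_injective]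
    exact hT0
  let Φ : LaurentSeries K →+* LaurentSeries L := IsLocalization.Away.lift PowerSeries.X hunit
  have hΦ (u : PowerSeries K) : Φ (ofPowerSeries ℤ K u) = ofPowerSeries ℤ L (s u) :=
    IsLocalization.Away.lift_eq PowerSeries.X hunit u
  refine ⟨Φ, fun u => ⟨s u, s0 u, hΦ u⟩, ?_, fun c => ?_⟩
  · rw [← ofPowerSeries_X, hΦ, sX]
  · rw [← ofPowerSeries_C, hΦ, sC, ofPowerSeries_C]

end Subst

end LaurentSeries

namespace LaurentSeries

open HahnSeries

section Representation

variable {p : ℕ} {E : Type*} [Field E]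

/-- If `ι` multiplies orders by `p`, then the elements `Y ^ j` with `j < p`, for `Y` the
variable, are linearly independent over the image of `ι`. -/
theorem sum_map_mul_variable_pow_ne_zero {K : Type*} [Field K]
    {ι : LaurentSeries K →+* LaurentSeries E} {g : K →+* E} (hι : Reduces ι g)
    (hιX : HasLead (ι (single 1 1)) p 1) {c : Fin p → LaurentSeries K} (hc : c ≠ 0) :
    ∑ j, ι (c j) * (single 1 1 : LaurentSeries E) ^ (j : ℕ) ≠ 0 := by
  obtain ⟨j₀, hj₀⟩ := Function.ne_iff.mp hc
  refine sum_ne_zero_of_hasLead (N := fun j : Fin p => p * (c j).order + 1 * j + 0)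
    (c := fun j => g ((c j).coeff (c j).order)) (fun j _ => ?_) (fun j hj => ?_)
    (injective_mul_add_mul isUnit_one _ 0) ⟨j₀, ?_⟩
  · convert (hι.hasLead hιX (HasLead.of_le_order (c j) le_rfl)).mul
      ((HasLead.single 1 (1 : E)).pow j) using 1 <;> simp
  · rw [map_eq_zero, coeff_order_eq_zero] at hj
    rw [hj, map_zero, zero_mul]
  · rw [map_ne_zero]
    exact mt coeff_order_eq_zero.mp hj₀

/-- Leading terms of `∑ j, φ (c j) * (Y ^ j * σ^[j] m)`. -/
theorem exists_hasLead_sum {K : Type*} [Field K] {ι : K →+* E}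
    {φ : LaurentSeries K →+* LaurentSeries E} {σ : LaurentSeries E →+* LaurentSeries E} {y : E}
    (hφ : Reduces φ ι) (hφX : HasLead (φ (single 1 1)) p 1)
    (hσ : Reduces σ (RingHom.id E)) (hσX : HasLead (σ (single 1 1)) 1 1)
    (hy : ∀ c : Fin p → K, c ≠ 0 → ∑ j, ι (c j) * y ^ (j : ℕ) ≠ 0)
    {c : Fin p → LaurentSeries K} (hc : c ≠ 0) {m : LaurentSeries E} (hm : m ≠ 0) :
    ∃ (n : ℤ) (d : E), d ≠ 0 ∧
      HasLead (∑ j, φ (c j) * (HahnSeries.C y ^ (j : ℕ) * σ^[j] m)) (p * n + m.order) d := by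
  classical
  obtain ⟨j₀, hj₀⟩ := Function.ne_iff.mp hc
  obtain ⟨i, hi, hmin⟩ := Finset.exists_min_image (Finset.univ.filter fun j => c j ≠ 0)
    (fun j => (c j).order) ⟨j₀, by simpa using hj₀⟩
  simp only [Finset.mem_filter, Finset.mem_univ, true_and] at hi hmin
  set n := (c i).order with hn
  have hm_lead : ∀ j : ℕ, HasLead (σ^[j] m) m.order (m.coeff m.order) := by
    intro j
    induction j with
    | zero => exact HasLead.of_le_order m le_rfl
    | succ j ih =>
      rw [Function.iterate_succ_apply']
      simpa using hσ.hasLead hσX ih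
  have hc_lead (j : Fin p) : HasLead (c j) n ((c j).coeff n) := by
    by_cases hj : c j = 0
    · rw [hj, coeff_zero]
      exact HasLead.zero n
    · exact HasLead.of_le_order _ (hmin j hj)
  refine ⟨n, (∑ j, ι ((c j).coeff n) * y ^ (j : ℕ)) * m.coeff m.order,
    mul_ne_zero (hy _ ?_) (mt coeff_order_eq_zero.mp hm), ?_⟩
  · exact Function.ne_iff.mpr ⟨i, mt coeff_order_eq_zero.mp hi⟩
  · rw [Finset.sum_mul]
    refine HasLead.sum _ fun j _ => ?_
    convert (hφ.hasLead hφX (hc_lead j)).mul (((HasLead.C y).pow j).mul (hm_lead j)) using 1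
    · ring
    · ring

/-- Nontrivial combinations of the operators `X ^ i * (Y * σ) ^ j`, where `X` is the inverse of the
variable, act injectively. -/
theorem sum_sum_ne_zero {K : Type*} [Field K] {ι : K →+* E}
    {φ : LaurentSeries K →+* LaurentSeries E} {σ : LaurentSeries E →+* LaurentSeries E} {y : E}
    (hφ : Reduces φ ι) (hφX : HasLead (φ (single 1 1)) p 1)
    (hσ : Reduces σ (RingHom.id E)) (hσX : HasLead (σ (single 1 1)) 1 1)
    (hy : ∀ c : Fin p → K, c ≠ 0 → ∑ j, ι (c j) * y ^ (j : ℕ) ≠ 0)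
    {c : Fin p → Fin p → LaurentSeries K} (hc : c ≠ 0) {m : LaurentSeries E} (hm : m ≠ 0) :
    ∑ i, ∑ j, φ (c i j) *
      ((single 1 1 : LaurentSeries E)⁻¹ ^ (i : ℕ) * (HahnSeries.C y ^ (j : ℕ) * σ^[j] m)) ≠ 0 := by
  classical
  have row (i : Fin p) : ∃ (n : ℤ) (d : E), (c i ≠ 0 → d ≠ 0) ∧ (c i = 0 → d = 0) ∧
      HasLead (∑ j, φ (c i j) * (HahnSeries.C y ^ (j : ℕ) * σ^[j] m)) (p * n + m.order) d := by
    by_cases hi : c i = 0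
    · exact ⟨0, 0, fun h => absurd hi h, fun _ => rfl, by simpa [hi] using HasLead.zero _⟩
    · obtain ⟨n, d, hd, h⟩ := exists_hasLead_sum hφ hφX hσ hσX hy hi hm
      exact ⟨n, d, fun _ => hd, fun h => absurd h hi, h⟩
  choose n d hd hd0 hlead using row
  obtain ⟨i₀, hi₀⟩ := Function.ne_iff.mp hc
  refine sum_ne_zero_of_hasLead (N := fun i : Fin p => p * n i + -1 * i + m.order) (c := d)
    (fun i _ => ?_) (fun i hi => ?_) (injective_mul_add_mul isUnit_one.neg _ _) ⟨i₀, hd _ hi₀⟩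
  · have hX : HasLead ((single 1 1 : LaurentSeries E)⁻¹ ^ (i : ℕ)) (-i) 1 := by
      convert ((HasLead.single 1 (1 : E)).inv one_ne_zero).pow i using 1 <;> simp
    convert hX.mul (hlead i) using 1
    · rw [Finset.mul_sum]
      exact Finset.sum_congr rfl fun j _ => mul_left_comm _ _ _
    · ring
    · rw [one_mul]
  · have : c i = 0 := by
      by_contra h
      exact hd i h hi
    simp [this]

end Representation

theorem coe_inv {K : Type*} [Field K] {u : PowerSeries K} (hu : PowerSeries.constantCoeff u ≠ 0) :
    ofPowerSeries ℤ K u⁻¹ = (ofPowerSeries ℤ K u)⁻¹ := by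
  refine eq_inv_of_mul_eq_one_left ?_
  rw [← map_mul, PowerSeries.inv_mul_cancel _ hu, map_one]

theorem hasLead_X_pow_mul {K : Type*} [Field K] {u : PowerSeries K}
    (hu : PowerSeries.constantCoeff u = 1) (n : ℕ) :
    HasLead (ofPowerSeries ℤ K (PowerSeries.X ^ n * u)) n 1 :=
  ⟨u, hu, by rw [map_mul, ofPowerSeries_X_pow]⟩

/-- The symbol algebra `[β⁻¹, α)` over `k((α))((β))` is a division algebra: it acts on
`k((y))((t))` with `α = y ^ p`, `β = (t⁻ᵖ - t⁻¹)⁻¹`, the generators acting as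
multiplication by `t⁻¹` and as `y` times the substitution `t⁻¹ ↦ t⁻¹ + 1`. -/
theorem symbol_isDivisionAlgebra {p : ℕ} (hp : p.Prime) (k : Type) [Field k] [CharP k p] :
    IsDivisionAlgebra (ASSymbol (LaurentSeries (LaurentSeries k)) p
      (single 1 1)⁻¹ (HahnSeries.C (single 1 1))) := by
  have : Fact p.Prime := ⟨hp⟩
  have : CharP (LaurentSeries (LaurentSeries k)) p :=
    charP_of_injective_ringHom
      ((HahnSeries.C : LaurentSeries k →+* LaurentSeries (LaurentSeries k)).comp
        (HahnSeries.C : k →+* LaurentSeries k)).injective p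
  have hp1 : p - 1 ≠ 0 := by have := hp.two_le; omega
  obtain ⟨ι, hι, hιX, -⟩ := exists_subst (RingHom.id k) (T := PowerSeries.X ^ p)
    (by simp [hp.ne_zero]) (pow_ne_zero _ PowerSeries.X_ne_zero)
  rw [ofPowerSeries_X_pow] at hιX
  let v : PowerSeries (LaurentSeries k) := 1 - PowerSeries.X ^ (p - 1)
  have hv : PowerSeries.constantCoeff v = 1 := by simp [v, hp1]
  have hv' : PowerSeries.constantCoeff v⁻¹ = 1 := by simp [hv]
  let w : PowerSeries (LaurentSeries k) := 1 + PowerSeries.X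
  have hw : PowerSeries.constantCoeff w = 1 := by simp [w]
  have hw' : PowerSeries.constantCoeff w⁻¹ = 1 := by simp [hw]
  obtain ⟨φ, hφ, hφX, hφC⟩ := exists_subst ι (T := PowerSeries.X ^ p * v⁻¹)
    (by simp [hp.ne_zero]) (mul_ne_zero (pow_ne_zero _ PowerSeries.X_ne_zero)
      (by rintro h; simp [h] at hv'))
  obtain ⟨σ, hσ, hσX, hσC⟩ := exists_subst (RingHom.id (LaurentSeries k))
    (T := PowerSeries.X ^ 1 * w⁻¹)
    (by simp) (mul_ne_zero (pow_ne_zero _ PowerSeries.X_ne_zero)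
      (by rintro h; simp [h] at hw'))
  have leadφ : HasLead (φ (single 1 1)) p 1 := hφX ▸ hasLead_X_pow_mul hv' p
  have leadσ : HasLead (σ (single 1 1)) 1 1 := by
    simpa using hσX ▸ hasLead_X_pow_mul hw' 1
  set t : LaurentSeries (LaurentSeries k) := single 1 1 with ht
  have ht0 : t ≠ 0 := single_ne_zero one_ne_zero
  have hφt : φ t = (t⁻¹ ^ p - t⁻¹)⁻¹ := by
    rw [hφX, map_mul, coe_inv (by rw [hv]; exact one_ne_zero), map_pow, ofPowerSeries_X, ← ht]
    simp only [v, map_sub, map_one, map_pow, ofPowerSeries_X, ← ht]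
    have h1 : t⁻¹ ^ p - t⁻¹ = t⁻¹ ^ p * (1 - t ^ (p - 1)) := by
      have : t ^ p = t ^ (p - 1) * t := by rw [← pow_succ, Nat.sub_add_cancel hp.one_le]
      have hp0 : t ^ p ≠ 0 := pow_ne_zero _ ht0
      rw [inv_pow]
      field_simp
      rw [this]
      ring
    rw [h1, mul_inv, inv_pow, inv_inv]
  have hσt : σ t⁻¹ = t⁻¹ + 1 := by
    rw [map_inv₀, hσX, map_mul, coe_inv (by rw [hw]; exact one_ne_zero), map_pow, ofPowerSeries_X,
      ← ht]
    simp only [w, map_add, map_one, ofPowerSeries_X, ← ht]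
    rw [mul_inv, inv_inv]
    field_simp
  have hσφt : σ (φ t) = φ t := by
    rw [hφt, map_inv₀, map_sub, map_pow, hσt, add_pow_char, one_pow]
    ring
  have hσφ : σ.comp φ = φ :=
    (hσ.comp hφ).ext hφ (fun c => by rw [RingHom.comp_apply, hφC, hσC, RingHom.id_apply]) hσφt
  have hpow : Reduces (σ ^ p) (RingHom.id _) ∧ (∀ c, (σ ^ p) (HahnSeries.C c) = HahnSeries.C c) ∧
      (σ ^ p) t⁻¹ = t⁻¹ + (p : LaurentSeries (LaurentSeries k)) := by
    generalize p = n
    induction n with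
    | zero => exact ⟨Reduces.id, fun c => rfl, by simp⟩
    | succ n ih =>
      obtain ⟨h1, h2, h3⟩ := ih
      rw [pow_succ']
      refine ⟨hσ.comp h1, fun c => ?_, ?_⟩
      · rw [RingHom.mul_def, RingHom.comp_apply, h2, hσC, RingHom.id_apply]
      · rw [RingHom.mul_def, RingHom.comp_apply, h3, map_add, hσt, map_natCast]
        push_cast
        ring
  have hσp : σ ^ p = RingHom.id _ := by
    refine hpow.1.ext Reduces.id hpow.2.1 ?_
    have := hpow.2.2
    rw [CharP.cast_eq_zero, add_zero, map_inv₀, inv_inj] at this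
    exact this
  refine ASSymbol.isDivisionAlgebra_of_semilinear (M := LaurentSeries (LaurentSeries k))
    hp.one_lt φ σ (fun c => RingHom.congr_fun hσφ c) (X := t⁻¹)
    (Y := HahnSeries.C (single 1 1)) ?_ ?_ hσt (hσC _) (fun m => ?_) fun c hc m hm => ?_
  · rw [map_inv₀, hφt, inv_inv]
  · rw [hφC, hιX, ← map_pow, single_pow]
    simp
  · rw [← RingHom.coe_pow, hσp, RingHom.id_apply]
  · refine sum_sum_ne_zero hφ leadφ hσ leadσ (fun c hc => ?_) hc hm
    exact sum_map_mul_variable_pow_ne_zero hι (hιX ▸ HasLead.single _ _) hc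

end LaurentSeries

/-- Let `p` be prime and `k` a field of characteristic `p`. Then the
degree-`p` symbol algebra `[β⁻¹, α)_{p,F}` over the iterated Laurent series field
`F = k((α))((β))` is a division algebra. -/
theorem iterLaurent_symbol_isDivision (p : ℕ) (hp : p.Prime) (k : Type) [Field k]
    [CharP k p] :
    IsDivisionAlgebra (ASSymbol (IterLaurent k 2) p
      (IterLaurent.var k 2 1)⁻¹ (IterLaurent.var k 2 0)) := by
  exact LaurentSeries.symbol_isDivisionAlgebra hp k
end
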